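/- arXiv:2208.04433 — 6 statements merged into one kernel-verified Lean document; each statement's English description precedes it below -/
import Mathlib

section
/- Let p₁, p₂, p₃, p₄ be i.i.d. real-valued random variables with an arbitrary common distribution μ, and let R₁, R₂, R₃, R₄ ∈ ℝ with R₁ ≥ R₂. Then Pr[R₂ + p₂ ≥ R_j + p_j for all j ∈ {1,2,3,4}] ≤ Pr[R₁ + p₁ ≥ R_j + p_j for all j ∈ {1,2,3,4}]. That is, the Follow-the-Perturbed-Leader update function is order-preserving (Assumption 3.4). -/
open MeasureTheory

/-- A product of copies of one measure is invariant under permuting the coordinates. -/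
theorem measurePreserving_comp_perm {ι α : Type*} [Fintype ι] [MeasurableSpace α]
    (μ : Measure α) [SigmaFinite μ] (σ : Equiv.Perm ι) :
    MeasurePreserving (fun p : ι → α => p ∘ σ)
      (Measure.pi fun _ => μ) (Measure.pi fun _ => μ) := by
  convert measurePreserving_piCongrLeft (fun _ : ι => μ) σ.symm using 1
  ext p i
  simpa [MeasurableEquiv.coe_piCongrLeft] using
    (Equiv.piCongrLeft_apply_apply (fun _ : ι => α) σ.symm p (σ i)).symm

/-- Let `p₁,…,p₄` be i.i.d. real random variables with arbitrary common
law `μ` (joint law the product measure `μ^⊗4`), and `R ∈ ℝ⁴` with `R₁ ≥ R₂`. Then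
`Pr[R₂ + p₂ ≥ R_j + p_j for all j] ≤ Pr[R₁ + p₁ ≥ R_j + p_j for all j]`: the FPL
update function is order-preserving. -/
theorem stmt_11 (μ : Measure ℝ) [IsProbabilityMeasure μ]
    (R : Fin 4 → ℝ) (h : R 1 ≤ R 0) :
    (Measure.pi fun _ : Fin 4 => μ)
        {p : Fin 4 → ℝ | ∀ j : Fin 4, R j + p j ≤ R 1 + p 1} ≤
      (Measure.pi fun _ : Fin 4 => μ)
        {p : Fin 4 → ℝ | ∀ j : Fin 4, R j + p j ≤ R 0 + p 0} := by
  have hmeas : MeasurableSet {p : Fin 4 → ℝ | ∀ j : Fin 4, R j + p j ≤ R 0 + p 0} := by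
    rw [Set.ofPred_forall]
    exact MeasurableSet.iInter fun j => measurableSet_le (by fun_prop) (by fun_prop)
  rw [← (measurePreserving_comp_perm μ (Equiv.swap (0 : Fin 4) 1)).measure_preimage
    hmeas.nullMeasurableSet]
  refine measure_mono fun p hp j => ?_
  have h0 := hp 0
  have hj := hp j
  simp only [Function.comp_apply, Equiv.swap_apply_left]
  by_cases hj0 : j = 0
  · simp [hj0]
  by_cases hj1 : j = 1
  · rw [hj1, Equiv.swap_apply_right]
    linarith
  · rw [Equiv.swap_apply_of_ne_of_ne hj0 hj1]
    linarith
end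

section
/- Let P(1,1), P(1,0), P(0,1), P(0,0) be real numbers summing to 1. Then for all p₀, p₁, q₀, q₁ ∈ ℝ, the expected one-round CA payoff satisfies the polynomial identity U(p₀,p₁,q₀,q₁) = 2·(P(1,1)P(0,0) − P(1,0)P(0,1))·(p₀ + p₁ − 1)·(q₀ + q₁ − 1). -/
/-- Let `P(1,1), P(1,0), P(0,1), P(0,0)` be real numbers summing to 1.
Then for all `p₀, p₁, q₀, q₁ ∈ ℝ`, the expected one-round CA payoff `U = A − B` satisfies
`U(p₀,p₁,q₀,q₁) = 2·(P(1,1)P(0,0) − P(1,0)P(0,1))·(p₀ + p₁ − 1)·(q₀ + q₁ − 1)`. -/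
theorem stmt_14 (P11 P10 P01 P00 : ℝ)
    (hsum : P11 + P10 + P01 + P00 = 1)
    (U : ℝ → ℝ → ℝ → ℝ → ℝ)
    (hU : ∀ p₀ p₁ q₀ q₁ : ℝ, U p₀ p₁ q₀ q₁ =
      (P11 * (p₁ * q₁ + (1 - p₁) * (1 - q₁)) + P00 * (p₀ * q₀ + (1 - p₀) * (1 - q₀)) +
        P10 * (p₁ * (1 - q₀) + (1 - p₁) * q₀) + P01 * ((1 - p₀) * q₁ + p₀ * (1 - q₁))) -
      ((P11 + P10) * (P01 + P11) * (p₁ * q₁ + (1 - p₁) * (1 - q₁)) +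
        (P00 + P01) * (P10 + P00) * (p₀ * q₀ + (1 - p₀) * (1 - q₀)) +
        (P11 + P10) * (P00 + P10) * (p₁ * (1 - q₀) + (1 - p₁) * q₀) +
        (P01 + P00) * (P01 + P11) * ((1 - p₀) * q₁ + p₀ * (1 - q₁)))) :
    ∀ p₀ p₁ q₀ q₁ : ℝ,
      U p₀ p₁ q₀ q₁ = 2 * (P11 * P00 - P10 * P01) * (p₀ + p₁ - 1) * (q₀ + q₁ - 1) := by
  intro p₀ p₁ q₀ q₁
  obtain rfl : P00 = 1 - P11 - P10 - P01 := by linarith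
  rw [hU]
  ring
end

section
/- Suppose P is a positively correlated full-support distribution on {0,1}². Fix Bob at truth-telling, q₀ = q₁ = 1. Then for every (p₀, p₁) ∈ [0,1]² with (p₀,p₁) ≠ (1,1), U(p₀, p₁, 1, 1) < U(1, 1, 1, 1). In other words, truth-telling is the strict unique best response to truth-telling under the CA mechanism, so truth-telling by both agents is a strict Bayesian Nash equilibrium when agents use consistent strategies. -/
/-- Suppose `P` is a positively correlated full-support distribution on
`{0,1}²`. Fix Bob at truth-telling, `q₀ = q₁ = 1`. Then for every `(p₀, p₁) ∈ [0,1]²`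
with `(p₀,p₁) ≠ (1,1)`, `U(p₀, p₁, 1, 1) < U(1, 1, 1, 1)`: truth-telling is the strict
unique best response to truth-telling under the CA mechanism. -/
theorem stmt_15 (P11 P10 P01 P00 : ℝ)
    (hfull : 0 < P11 ∧ 0 < P10 ∧ 0 < P01 ∧ 0 < P00)
    (hsum : P11 + P10 + P01 + P00 = 1)
    (hposcorr : max P10 P01 < min P11 P00)
    (U : ℝ → ℝ → ℝ → ℝ → ℝ)
    (hU : ∀ p₀ p₁ q₀ q₁ : ℝ, U p₀ p₁ q₀ q₁ =
      (P11 * (p₁ * q₁ + (1 - p₁) * (1 - q₁)) + P00 * (p₀ * q₀ + (1 - p₀) * (1 - q₀)) +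
        P10 * (p₁ * (1 - q₀) + (1 - p₁) * q₀) + P01 * ((1 - p₀) * q₁ + p₀ * (1 - q₁))) -
      ((P11 + P10) * (P01 + P11) * (p₁ * q₁ + (1 - p₁) * (1 - q₁)) +
        (P00 + P01) * (P10 + P00) * (p₀ * q₀ + (1 - p₀) * (1 - q₀)) +
        (P11 + P10) * (P00 + P10) * (p₁ * (1 - q₀) + (1 - p₁) * q₀) +
        (P01 + P00) * (P01 + P11) * ((1 - p₀) * q₁ + p₀ * (1 - q₁)))) :
    ∀ p₀ p₁ : ℝ, p₀ ∈ Set.Icc (0 : ℝ) 1 → p₁ ∈ Set.Icc (0 : ℝ) 1 →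
      (p₀, p₁) ≠ (1, 1) → U p₀ p₁ 1 1 < U 1 1 1 1 := by
  intro p₀ p₁ h₀ h₁ hne
  obtain ⟨h11, h10, h01, h00⟩ := hfull
  obtain ⟨h_lt11, h_lt00⟩ := lt_min_iff.mp hposcorr
  have hdet : 0 < P11 * P00 - P10 * P01 :=
    sub_pos.mpr (mul_lt_mul'' ((le_max_left _ _).trans_lt h_lt11)
      ((le_max_right _ _).trans_lt h_lt00) h10.le h01.le)
  have hgap : U 1 1 1 1 - U p₀ p₁ 1 1 =
      2 * (P11 * P00 - P10 * P01) * ((1 - p₀) + (1 - p₁)) := by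
    obtain rfl : P00 = 1 - P11 - P10 - P01 := by linarith
    rw [hU, hU]
    ring
  have hpos : 0 < (1 - p₀) + (1 - p₁) := by
    by_contra! hle
    exact hne (Prod.ext (by linarith [h₀.2, h₁.2]) (by linarith [h₀.2, h₁.2]))
  have : 0 < U 1 1 1 1 - U p₀ p₁ 1 1 := by
    rw [hgap]
    positivity
  exact sub_pos.mp this
end

section
/- Suppose P is a positively correlated full-support distribution on {0,1}², and fix Bob's strategy (q₀, q₁) ∈ [0,1]². Then: (i) if q₀ + q₁ > 1, the unique maximizer of (p₀,p₁) ↦ U(p₀,p₁,q₀,q₁) over [0,1]² is (1,1); (ii) if q₀ + q₁ < 1, the unique maximizer is (0,0); (iii) if q₀ + q₁ = 1, then U(p₀,p₁,q₀,q₁) = 0 for every (p₀,p₁) ∈ [0,1]². -/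
/-- Suppose `P` is a positively correlated full-support distribution on
`{0,1}²` and fix Bob's strategy `(q₀, q₁) ∈ [0,1]²`. Then:
(i) if `q₀ + q₁ > 1`, the unique maximizer of `(p₀,p₁) ↦ U(p₀,p₁,q₀,q₁)` over `[0,1]²`
is `(1,1)`; (ii) if `q₀ + q₁ < 1`, the unique maximizer is `(0,0)`; (iii) if
`q₀ + q₁ = 1`, then `U(p₀,p₁,q₀,q₁) = 0` for every `(p₀,p₁) ∈ [0,1]²`. -/
theorem stmt_16 (P11 P10 P01 P00 : ℝ)
    (hfull : 0 < P11 ∧ 0 < P10 ∧ 0 < P01 ∧ 0 < P00)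
    (hsum : P11 + P10 + P01 + P00 = 1)
    (hposcorr : max P10 P01 < min P11 P00)
    (U : ℝ → ℝ → ℝ → ℝ → ℝ)
    (hU : ∀ p₀ p₁ q₀ q₁ : ℝ, U p₀ p₁ q₀ q₁ =
      (P11 * (p₁ * q₁ + (1 - p₁) * (1 - q₁)) + P00 * (p₀ * q₀ + (1 - p₀) * (1 - q₀)) +
        P10 * (p₁ * (1 - q₀) + (1 - p₁) * q₀) + P01 * ((1 - p₀) * q₁ + p₀ * (1 - q₁))) -
      ((P11 + P10) * (P01 + P11) * (p₁ * q₁ + (1 - p₁) * (1 - q₁)) +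
        (P00 + P01) * (P10 + P00) * (p₀ * q₀ + (1 - p₀) * (1 - q₀)) +
        (P11 + P10) * (P00 + P10) * (p₁ * (1 - q₀) + (1 - p₁) * q₀) +
        (P01 + P00) * (P01 + P11) * ((1 - p₀) * q₁ + p₀ * (1 - q₁))))
    (q₀ q₁ : ℝ) (hq₀ : q₀ ∈ Set.Icc (0 : ℝ) 1) (hq₁ : q₁ ∈ Set.Icc (0 : ℝ) 1) :
    (1 < q₀ + q₁ →
      ∀ p₀ p₁ : ℝ, p₀ ∈ Set.Icc (0 : ℝ) 1 → p₁ ∈ Set.Icc (0 : ℝ) 1 →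
        (p₀, p₁) ≠ (1, 1) → U p₀ p₁ q₀ q₁ < U 1 1 q₀ q₁) ∧
    (q₀ + q₁ < 1 →
      ∀ p₀ p₁ : ℝ, p₀ ∈ Set.Icc (0 : ℝ) 1 → p₁ ∈ Set.Icc (0 : ℝ) 1 →
        (p₀, p₁) ≠ (0, 0) → U p₀ p₁ q₀ q₁ < U 0 0 q₀ q₁) ∧
    (q₀ + q₁ = 1 →
      ∀ p₀ p₁ : ℝ, p₀ ∈ Set.Icc (0 : ℝ) 1 → p₁ ∈ Set.Icc (0 : ℝ) 1 →
        U p₀ p₁ q₀ q₁ = 0) := by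
  obtain ⟨h11, h10, h01, h00⟩ := hfull
  obtain ⟨⟨h1, -⟩, -, h4⟩ : (P10 < P11 ∧ P01 < P11) ∧ P10 < P00 ∧ P01 < P00 := by
    simpa only [max_lt_iff, lt_min_iff] using hposcorr
  have hdet : 0 < P11 * P00 - P10 * P01 :=
    sub_pos.2 (mul_lt_mul'' h1 h4 h10.le h01.le)
  have hfactor : ∀ p₀ p₁, U p₀ p₁ q₀ q₁ =
      2 * (P11 * P00 - P10 * P01) * ((p₀ + p₁ - 1) * (q₀ + q₁ - 1)) := by
    intro p₀ p₁
    obtain rfl : P00 = 1 - P11 - P10 - P01 := by linarith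
    rw [hU]
    ring
  simp only [hfactor]
  refine ⟨?_, ?_, ?_⟩
  · rintro hq p₀ p₁ ⟨-, hp₀⟩ ⟨-, hp₁⟩ hne
    have hp : p₀ + p₁ < 2 := by
      by_contra! h
      exact hne (Prod.ext (by linarith) (by linarith))
    exact mul_lt_mul_of_pos_left
      (mul_lt_mul_of_pos_right (by linarith) (by linarith)) (by linarith)
  · rintro hq p₀ p₁ ⟨hp₀, -⟩ ⟨hp₁, -⟩ hne
    have hp : 0 < p₀ + p₁ := by
      by_contra! h
      exact hne (Prod.ext (by linarith) (by linarith))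
    exact mul_lt_mul_of_pos_left
      (mul_lt_mul_of_neg_right (by linarith) (by linarith)) (by linarith)
  · intro hq p₀ p₁ _ _
    rw [hq]
    ring
end

section
/- Suppose P is a positively correlated full-support distribution on {0,1}², and both agents receive the common expected payoff U. Call a profile (p₀*,p₁*,q₀*,q₁*) ∈ [0,1]⁴ a Nash equilibrium if U(p₀*,p₁*,q₀*,q₁*) ≥ U(p₀,p₁,q₀*,q₁*) for all (p₀,p₁) ∈ [0,1]² and U(p₀*,p₁*,q₀*,q₁*) ≥ U(p₀*,p₁*,q₀,q₁) for all (q₀,q₁) ∈ [0,1]². Then (p₀*,p₁*,q₀*,q₁*) is a Nash equilibrium if and only if it is one of the following three types: (1) truth-telling by both agents, p₀* = p₁* = q₀* = q₁* = 1; (2) flipping by both agents, p₀* = p₁* = q₀* = q₁* = 0; (3) uninformative reporting by both agents, p₀* + p₁* = 1 and q₀* + q₁* = 1. -/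
/-- The expected payoff factors through the informativeness `p₀ + p₁ - 1` and `q₀ + q₁ - 1`
of the two strategies, with coefficient twice the determinant of the signal distribution. -/
theorem ca_payoff_eq {P11 P10 P01 P00 : ℝ}
    (hsum : P11 + P10 + P01 + P00 = 1) (p₀ p₁ q₀ q₁ : ℝ) :
    (P11 * (p₁ * q₁ + (1 - p₁) * (1 - q₁)) + P00 * (p₀ * q₀ + (1 - p₀) * (1 - q₀)) +
        P10 * (p₁ * (1 - q₀) + (1 - p₁) * q₀) + P01 * ((1 - p₀) * q₁ + p₀ * (1 - q₁))) -
      ((P11 + P10) * (P01 + P11) * (p₁ * q₁ + (1 - p₁) * (1 - q₁)) +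
        (P00 + P01) * (P10 + P00) * (p₀ * q₀ + (1 - p₀) * (1 - q₀)) +
        (P11 + P10) * (P00 + P10) * (p₁ * (1 - q₀) + (1 - p₁) * q₀) +
        (P01 + P00) * (P01 + P11) * ((1 - p₀) * q₁ + p₀ * (1 - q₁))) =
      2 * (P11 * P00 - P10 * P01) * ((p₀ + p₁ - 1) * (q₀ + q₁ - 1)) := by
  obtain rfl : P11 = 1 - P10 - P01 - P00 := by linarith
  ring

/-- Suppose `P` is a positively correlated full-support distribution on
`{0,1}²` and both agents receive the common expected payoff `U`. A profile
`(p₀*,p₁*,q₀*,q₁*) ∈ [0,1]⁴` is a Nash equilibrium (neither Alice nor Bob can improve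
`U` by a unilateral deviation within `[0,1]²`) if and only if it is one of:
(1) truth-telling by both agents: `p₀* = p₁* = q₀* = q₁* = 1`;
(2) flipping by both agents: `p₀* = p₁* = q₀* = q₁* = 0`;
(3) uninformative reporting by both agents: `p₀* + p₁* = 1` and `q₀* + q₁* = 1`. -/
theorem stmt_17 (P11 P10 P01 P00 : ℝ)
    (hfull : 0 < P11 ∧ 0 < P10 ∧ 0 < P01 ∧ 0 < P00)
    (hsum : P11 + P10 + P01 + P00 = 1)
    (hposcorr : max P10 P01 < min P11 P00)
    (U : ℝ → ℝ → ℝ → ℝ → ℝ)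
    (hU : ∀ p₀ p₁ q₀ q₁ : ℝ, U p₀ p₁ q₀ q₁ =
      (P11 * (p₁ * q₁ + (1 - p₁) * (1 - q₁)) + P00 * (p₀ * q₀ + (1 - p₀) * (1 - q₀)) +
        P10 * (p₁ * (1 - q₀) + (1 - p₁) * q₀) + P01 * ((1 - p₀) * q₁ + p₀ * (1 - q₁))) -
      ((P11 + P10) * (P01 + P11) * (p₁ * q₁ + (1 - p₁) * (1 - q₁)) +
        (P00 + P01) * (P10 + P00) * (p₀ * q₀ + (1 - p₀) * (1 - q₀)) +
        (P11 + P10) * (P00 + P10) * (p₁ * (1 - q₀) + (1 - p₁) * q₀) +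
        (P01 + P00) * (P01 + P11) * ((1 - p₀) * q₁ + p₀ * (1 - q₁))))
    (p₀ p₁ q₀ q₁ : ℝ)
    (hp₀ : p₀ ∈ Set.Icc (0 : ℝ) 1) (hp₁ : p₁ ∈ Set.Icc (0 : ℝ) 1)
    (hq₀ : q₀ ∈ Set.Icc (0 : ℝ) 1) (hq₁ : q₁ ∈ Set.Icc (0 : ℝ) 1) :
    ((∀ p₀' p₁' : ℝ, p₀' ∈ Set.Icc (0 : ℝ) 1 → p₁' ∈ Set.Icc (0 : ℝ) 1 →
        U p₀' p₁' q₀ q₁ ≤ U p₀ p₁ q₀ q₁) ∧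
     (∀ q₀' q₁' : ℝ, q₀' ∈ Set.Icc (0 : ℝ) 1 → q₁' ∈ Set.Icc (0 : ℝ) 1 →
        U p₀ p₁ q₀' q₁' ≤ U p₀ p₁ q₀ q₁)) ↔
    ((p₀ = 1 ∧ p₁ = 1 ∧ q₀ = 1 ∧ q₁ = 1) ∨
     (p₀ = 0 ∧ p₁ = 0 ∧ q₀ = 0 ∧ q₁ = 0) ∨
     (p₀ + p₁ = 1 ∧ q₀ + q₁ = 1)) := by
  obtain ⟨_, h10, h01, _⟩ := hfull
  have hD : 0 < P11 * P00 - P10 * P01 := by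
    have h1 : P10 < P11 := lt_of_le_of_lt (le_max_left _ _) (hposcorr.trans_le (min_le_left _ _))
    have h2 : P01 < P00 := lt_of_le_of_lt (le_max_right _ _) (hposcorr.trans_le (min_le_right _ _))
    exact sub_pos.2 (mul_lt_mul'' h1 h2 h10.le h01.le)
  have hUle (a b c d a' b' c' d' : ℝ) : U a b c d ≤ U a' b' c' d' ↔
      (a + b - 1) * (c + d - 1) ≤ (a' + b' - 1) * (c' + d' - 1) := by
    rw [hU, hU, ca_payoff_eq hsum, ca_payoff_eq hsum]
    exact mul_le_mul_iff_right₀ (mul_pos two_pos hD)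
  simp only [hUle, Set.mem_Icc] at *
  constructor
  · rintro ⟨hA, hB⟩
    have hA1 := hA 1 1 (by norm_num) (by norm_num)
    have hA0 := hA 0 0 (by norm_num) (by norm_num)
    have hB1 := hB 1 1 (by norm_num) (by norm_num)
    have hB0 := hB 0 0 (by norm_num) (by norm_num)
    rcases lt_trichotomy (q₀ + q₁ - 1) 0 with ht | ht | ht
    · have hs : p₀ + p₁ ≤ 0 := by nlinarith
      have hp : p₀ = 0 ∧ p₁ = 0 := by constructor <;> linarith
      rw [hp.1, hp.2] at hB0
      refine Or.inr (Or.inl ⟨hp.1, hp.2, ?_, ?_⟩) <;> linarith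
    · rw [ht] at hB1 hB0
      refine Or.inr (Or.inr ⟨?_, ?_⟩) <;> linarith
    · have hs : 2 ≤ p₀ + p₁ := by nlinarith
      have hp : p₀ = 1 ∧ p₁ = 1 := by constructor <;> linarith
      rw [hp.1, hp.2] at hB1
      refine Or.inl ⟨hp.1, hp.2, ?_, ?_⟩ <;> linarith
  · rintro (⟨rfl, rfl, rfl, rfl⟩ | ⟨rfl, rfl, rfl, rfl⟩ | ⟨hp, hq⟩)
    · constructor <;> intro a b ha hb <;> linarith
    · constructor <;> intro a b ha hb <;> linarith
    · simp [hp, hq]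
end

section
/- Suppose P is a positively correlated full-support distribution on {0,1}². Then the truth-telling profile yields expected payoff U(1,1,1,1) = 2(P(1,1)P(0,0) − P(1,0)P(0,1)) > 0, while every uninformative profile (one with p₀ + p₁ = 1 and q₀ + q₁ = 1) yields U = 0. Hence the CA mechanism is strongly truthful: the expected payoff of each agent at the truth-telling equilibrium is strictly higher than at any non-permutation (uninformative) equilibrium. -/
/-- Suppose `P` is a positively correlated full-support distribution on
`{0,1}²`. Then the truth-telling profile yields expected payoff
`U(1,1,1,1) = 2(P(1,1)P(0,0) − P(1,0)P(0,1)) > 0`, while every uninformative profile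
(`p₀ + p₁ = 1` and `q₀ + q₁ = 1`) yields `U = 0`. Hence the CA mechanism is strongly
truthful: truth-telling strictly beats any non-permutation (uninformative) equilibrium. -/
theorem stmt_18 (P11 P10 P01 P00 : ℝ)
    (hfull : 0 < P11 ∧ 0 < P10 ∧ 0 < P01 ∧ 0 < P00)
    (hsum : P11 + P10 + P01 + P00 = 1)
    (hposcorr : max P10 P01 < min P11 P00)
    (U : ℝ → ℝ → ℝ → ℝ → ℝ)
    (hU : ∀ p₀ p₁ q₀ q₁ : ℝ, U p₀ p₁ q₀ q₁ =
      (P11 * (p₁ * q₁ + (1 - p₁) * (1 - q₁)) + P00 * (p₀ * q₀ + (1 - p₀) * (1 - q₀)) +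
        P10 * (p₁ * (1 - q₀) + (1 - p₁) * q₀) + P01 * ((1 - p₀) * q₁ + p₀ * (1 - q₁))) -
      ((P11 + P10) * (P01 + P11) * (p₁ * q₁ + (1 - p₁) * (1 - q₁)) +
        (P00 + P01) * (P10 + P00) * (p₀ * q₀ + (1 - p₀) * (1 - q₀)) +
        (P11 + P10) * (P00 + P10) * (p₁ * (1 - q₀) + (1 - p₁) * q₀) +
        (P01 + P00) * (P01 + P11) * ((1 - p₀) * q₁ + p₀ * (1 - q₁)))) :
    U 1 1 1 1 = 2 * (P11 * P00 - P10 * P01) ∧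
    0 < U 1 1 1 1 ∧
    (∀ p₀ p₁ q₀ q₁ : ℝ,
      p₀ ∈ Set.Icc (0 : ℝ) 1 → p₁ ∈ Set.Icc (0 : ℝ) 1 →
      q₀ ∈ Set.Icc (0 : ℝ) 1 → q₁ ∈ Set.Icc (0 : ℝ) 1 →
      p₀ + p₁ = 1 → q₀ + q₁ = 1 →
      U p₀ p₁ q₀ q₁ = 0 ∧ U p₀ p₁ q₀ q₁ < U 1 1 1 1) := by
  obtain ⟨h11, h10, h01, h00⟩ := hfull
  obtain ⟨hmax10, hmax01⟩ := max_lt_iff.mp hposcorr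
  have hlt11 : P10 < P11 := (lt_min_iff.mp hmax10).1
  have hlt00 : P01 < P00 := (lt_min_iff.mp hmax01).2
  have hdet : 0 < P11 * P00 - P10 * P01 :=
    sub_pos.mpr (mul_lt_mul'' hlt11 hlt00 h10.le h01.le)
  have htruth : U 1 1 1 1 = 2 * (P11 * P00 - P10 * P01) := by
    rw [hU]
    linear_combination (-(P11 + P00)) * hsum
  have hpos : 0 < U 1 1 1 1 := by
    rw [htruth]
    exact mul_pos two_pos hdet
  refine ⟨htruth, hpos, fun p₀ p₁ q₀ q₁ _ _ _ _ hp hq => ?_⟩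
  have hzero : U p₀ p₁ q₀ q₁ = 0 := by
    obtain rfl : p₀ = 1 - p₁ := by linarith
    obtain rfl : q₀ = 1 - q₁ := by linarith
    obtain rfl : P00 = 1 - P11 - P10 - P01 := by linarith
    rw [hU]
    ring
  exact ⟨hzero, hzero ▸ hpos⟩
end
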